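/- Let q be a prime power and assume the MDS conjecture holds for q, i.e., every linear [n, k, n−k+1]_q MDS code with 2 ≤ k ≤ n−2 satisfies n ≤ q+1, except that when q is even and k = 3 or k = q−1 it satisfies n ≤ q+2. If there exist F_q-linear codes C ⊂ C′ in F_q^{q+1} with C a linear [q+1, k, q−k+2]_q MDS code and C′ a linear [q+1, k+1, q−k+1]_q MDS code for some integer k with 1 ≤ k ≤ q−1, then q is even and k ∈ {2, q−2}. -/

import Mathlib

open Classical in
/-- Hamming weight of a vector: the number of nonzero coordinates. -/
noncomputable def hWt {F : Type*} [Zero F] {n : ℕ} (v : Fin n → F) : ℕ :=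
  (Finset.univ.filter fun i => v i ≠ 0).card

/-- `C` is a linear `[n,k,d]_q` code: a `k`-dimensional subspace of `F^n`
whose minimum Hamming weight of nonzero codewords is exactly `d`. -/
def IsCodeWith {F : Type*} [Field F] (n k d : ℕ) (C : Submodule F (Fin n → F)) : Prop :=
  Module.finrank F C = k ∧
  (∃ v ∈ C, v ≠ 0 ∧ hWt v = d) ∧
  (∀ v ∈ C, v ≠ 0 → d ≤ hWt v)

theorem hWt_cons_aux {F : Type*} [Zero F] {n : ℕ} (a : F) (v : Fin n → F) [Decidable (a ≠ 0)] :
    hWt (Fin.cons a v : Fin (n+1) → F) = (if a ≠ 0 then 1 else 0) + hWt v := by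
  unfold hWt
  rw [Finset.card_filter, Finset.card_filter, Fin.sum_univ_succ]
  simp only [Fin.cons_zero, Fin.cons_succ]
  congr

def consMap_aux {F : Type*} [Field F] {n : ℕ} (f : (Fin n → F) →ₗ[F] F) :
    (Fin n → F) →ₗ[F] (Fin (n+1) → F) where
  toFun v := Fin.cons (f v) v
  map_add' v w := by
    ext i
    refine Fin.cases ?_ (fun j => ?_) i <;> simp
  map_smul' c w := by
    ext i
    refine Fin.cases ?_ (fun j => ?_) i <;> simp

theorem stmt10 {q k : ℕ} (hq : IsPrimePow q)
    {F : Type*} [Field F] [Fintype F] (hcard : Fintype.card F = q)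
    -- the MDS conjecture for `q`:
    (hMDS : ∀ (n k' : ℕ) (C : Submodule F (Fin n → F)), 2 ≤ k' → k' ≤ n - 2 →
      IsCodeWith n k' (n - k' + 1) C →
      (n ≤ q + 1 ∨ (Even q ∧ (k' = 3 ∨ k' = q - 1) ∧ n ≤ q + 2)))
    (hk : 1 ≤ k) (hkq : k ≤ q - 1)
    (C C' : Submodule F (Fin (q + 1) → F)) (hCC' : C < C')
    (hC : IsCodeWith (q + 1) k (q - k + 2) C)
    (hC' : IsCodeWith (q + 1) (k + 1) (q - k + 1) C') :
    Even q ∧ (k = 2 ∨ k = q - 2) := by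
  classical
  obtain ⟨hle, w, hwC', hwC⟩ := SetLike.lt_iff_le_and_exists.mp hCC'
  obtain ⟨f, hfw, hfm⟩ := Submodule.exists_dual_map_eq_bot_of_notMem hwC inferInstance
  have hfC : C ≤ LinearMap.ker f := LinearMap.le_ker_iff_map.mpr hfm
  obtain ⟨hdim, ⟨v0, hv0, hv0n, hv0w⟩, hmin⟩ := hC
  obtain ⟨hdim', -, hmin'⟩ := hC'
  have hker : C = C' ⊓ LinearMap.ker f := by
    apply Submodule.eq_of_le_of_finrank_le (le_inf hle hfC)
    have : C' ⊓ LinearMap.ker f < C' := by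
      refine lt_of_le_of_ne inf_le_left fun h => hfw ?_
      have : w ∈ C' ⊓ LinearMap.ker f := by rw [h]; exact hwC'
      exact this.2
    have := Submodule.finrank_lt_finrank_of_lt this
    omega
  have hinj : Function.Injective (consMap_aux f) := by
    intro a b hab
    ext i
    exact congrFun hab i.succ
  have hcode : IsCodeWith (q + 2) (k + 1) (q + 2 - (k + 1) + 1) (C'.map (consMap_aux f)) := by
    have hd : q + 2 - (k + 1) + 1 = q - k + 2 := by omega
    rw [hd]
    refine ⟨?_, ⟨consMap_aux f v0, ⟨v0, hle hv0, rfl⟩, ?_, ?_⟩, ?_⟩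
    · rw [← hdim']
      exact (Submodule.equivMapOfInjective _ hinj C').finrank_eq.symm
    · intro h
      exact hv0n (hinj (h.trans (map_zero _).symm))
    · have h0 : f v0 = 0 := hfC hv0
      have := hWt_cons_aux (f v0) v0
      rw [if_neg (by simp [h0]), zero_add, hv0w] at this
      exact this
    · rintro _ ⟨v, hv, rfl⟩ hne
      have hvn : v ≠ 0 := by
        rintro rfl
        exact hne (map_zero _)
      have h1 := hWt_cons_aux (f v) v
      change _ ≤ hWt (Fin.cons (f v) v : Fin (q+2) → F)
      rw [h1]
      by_cases h0 : f v = 0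
      · have : v ∈ C := by rw [hker]; exact ⟨hv, h0⟩
        have := hmin v this hvn
        omega
      · have := hmin' v hv hvn
        rw [if_pos h0]
        omega
  rcases hMDS (q + 2) (k + 1) _ (by omega) (by omega) hcode with h | ⟨h1, h2, -⟩
  · omega
  · exact ⟨h1, by omega⟩
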